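/- Let H be an m×n matrix over F₂, let i be a row index, and let H̃ be the single-row reduction of H at row i via a row expansion f of size r. Then every nonzero codeword c ∈ C(H̃) has Hamming weight at least d(H); in particular, if C(H) contains a nonzero vector then d(H̃) ≥ d(H), i.e., single-row reduction never decreases the minimum distance. -/

import Mathlib

open Matrix

/-- The `r × (r-1)` matrix `T_r` over `F₂` with `(T_r)_{j,k} = 1` iff `j = k` or
`j = k + 1`; it is the transpose of a parity-check matrix of the `[r,1,r]`
binary repetition code. -/
def Trep (r : ℕ) : Matrix (Fin r) (Fin (r - 1)) (ZMod 2) :=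
  Matrix.of fun j k => if (j : ℕ) = (k : ℕ) ∨ (j : ℕ) = (k : ℕ) + 1 then 1 else 0

/-- `f` is a row expansion of the row `h`: each column of `f` indexed by an element of the
support of `h` has Hamming weight exactly 1, and all other columns of `f` are zero. -/
def IsRowExpansion {κ : Type*} [Fintype κ] (h : κ → ZMod 2) {r : ℕ}
    (f : Matrix (Fin r) κ (ZMod 2)) : Prop :=
  ∀ j : κ, (h j ≠ 0 → hammingNorm (fun a => f a j) = 1) ∧ (h j = 0 → ∀ a, f a j = 0)

/-- The single-row reduction of `H` at row `i` via the expansion `f`: the rows of `H`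
other than row `i` are kept (extended by zeros in the new columns), and row `i` is
replaced by the block `(f | T_r)`. -/
def singleRowReduction {m n : ℕ} (H : Matrix (Fin m) (Fin n) (ZMod 2)) (i : Fin m)
    {r : ℕ} (f : Matrix (Fin r) (Fin n) (ZMod 2)) :
    Matrix ({j : Fin m // j ≠ i} ⊕ Fin r) (Fin n ⊕ Fin (r - 1)) (ZMod 2) :=
  Matrix.of fun a b =>
    match a, b with
    | Sum.inl j, Sum.inl cc => H j.1 cc
    | Sum.inl _, Sum.inr _ => 0
    | Sum.inr a, Sum.inl cc => f a cc
    | Sum.inr a, Sum.inr k => Trep r a k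


/-- The minimum distance of the code `C(H)`: the least Hamming weight of a nonzero
vector in the kernel of `H`. -/
noncomputable def minDist {ι κ : Type*} [Fintype ι] [Fintype κ]
    (H : Matrix ι κ (ZMod 2)) : ℕ :=
  sInf {w | ∃ v : κ → ZMod 2, v ≠ 0 ∧ H.mulVec v = 0 ∧ hammingNorm v = w}

theorem Trep_mulVec {r : ℕ} (P : ℕ → ZMod 2) (h0 : P 0 = 0) (hr : P r = 0) (j : Fin r) :
    (Trep r).mulVec (fun k => P (k + 1)) j = P (j + 1) - P j := by
  obtain ⟨j, hj⟩ := j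
  have h1 : (Trep r).mulVec (fun k => P (k + 1)) ⟨j, hj⟩ =
      ∑ k ∈ Finset.range (r - 1), ((if j = k then P (k + 1) else 0) +
        (if j = k + 1 then P (k + 1) else 0)) := by
    rw [← Fin.sum_univ_eq_sum_range (fun k => (if j = k then P (k + 1) else 0) +
        (if j = k + 1 then P (k + 1) else 0)) (r - 1)]
    simp only [Matrix.mulVec, dotProduct, Trep, Matrix.of_apply]
    refine Finset.sum_congr rfl fun k _ => ?_
    by_cases h : j = (k : ℕ)
    · simp [h]
    · simp [h]
  rw [h1, Finset.sum_add_distrib, CharTwo.sub_eq_add]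
  congr 1
  · rw [Finset.sum_ite_eq]
    split_ifs with h
    · rfl
    · have : j + 1 = r := by
        rw [Finset.mem_range] at h
        omega
      simp [this, hr]
  · cases j with
    | zero => simp [h0]
    | succ j =>
      have : j < r - 1 := by omega
      simp [this]

/-- Every vector indexed by `Fin (r - 1)` extends to a sequence vanishing at `0` and `r`. -/
theorem exists_extension {r : ℕ} (w : Fin (r - 1) → ZMod 2) :
    ∃ P : ℕ → ZMod 2, P 0 = 0 ∧ P r = 0 ∧ w = fun k : Fin (r - 1) => P (k + 1) := by
  refine ⟨fun n => if h : 0 < n ∧ n < r then w ⟨n - 1, by omega⟩ else 0, by simp, by simp, ?_⟩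
  funext k
  have hk : (k : ℕ) + 1 < r := by omega
  simp [hk]

theorem sum_Trep_mulVec {r : ℕ} (w : Fin (r - 1) → ZMod 2) :
    ∑ j, (Trep r).mulVec w j = 0 := by
  obtain ⟨P, h0, hr, rfl⟩ := exists_extension w
  simp_rw [Trep_mulVec P h0 hr]
  rw [Fin.sum_univ_eq_sum_range (fun j => P (j + 1) - P j) r, Finset.sum_range_sub, h0, hr,
    sub_zero]

theorem eq_zero_of_Trep_mulVec_eq_zero {r : ℕ} {w : Fin (r - 1) → ZMod 2}
    (hw : (Trep r).mulVec w = 0) : w = 0 := by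
  obtain ⟨P, h0, hr, rfl⟩ := exists_extension w
  have hP : ∀ n ≤ r, P n = 0 := by
    intro n
    induction n with
    | zero => exact fun _ => h0
    | succ n ih =>
      intro hn
      have h := congrFun hw ⟨n, hn⟩
      rw [Trep_mulVec P h0 hr, ih (by omega)] at h
      simpa using h
  funext k
  exact hP _ (by omega)

theorem exists_Trep_mulVec_eq {r : ℕ} (g : Fin r → ZMod 2) (hg : ∑ j, g j = 0) :
    ∃ w, (Trep r).mulVec w = g := by
  set G : ℕ → ZMod 2 := fun n => if h : n < r then g ⟨n, h⟩ else 0 with hG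
  have hGg : ∀ j : Fin r, G j = g j := fun j => by simp [hG]
  refine ⟨fun k => ∑ a ∈ Finset.range (k + 1), G a, funext fun j => ?_⟩
  rw [Trep_mulVec (fun n => ∑ a ∈ Finset.range n, G a) (by simp) ?_ j]
  · simp [Finset.sum_range_succ, hGg]
  · simp only [← Fin.sum_univ_eq_sum_range, hGg, hg]

theorem natCast_hammingNorm {ι : Type*} [Fintype ι] (x : ι → ZMod 2) :
    (hammingNorm x : ZMod 2) = ∑ a, x a := by
  have h : ∀ y : ZMod 2, (if y ≠ 0 then 1 else 0) = y := by decide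
  rw [hammingNorm, ← Finset.sum_boole]
  exact Finset.sum_congr rfl fun a _ => h (x a)

theorem IsRowExpansion.sum_eq {κ : Type*} [Fintype κ] {h : κ → ZMod 2} {r : ℕ}
    {f : Matrix (Fin r) κ (ZMod 2)} (hf : IsRowExpansion h f) (j : κ) :
    ∑ a, f a j = h j := by
  by_cases hj : h j = 0
  · simp [(hf j).2 hj, hj]
  · have h1 : ∀ y : ZMod 2, y ≠ 0 → y = 1 := by decide
    rw [← natCast_hammingNorm fun a => f a j, (hf j).1 hj, h1 _ hj, Nat.cast_one]

theorem IsRowExpansion.sum_mulVec {κ : Type*} [Fintype κ] {h : κ → ZMod 2} {r : ℕ}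
    {f : Matrix (Fin r) κ (ZMod 2)} (hf : IsRowExpansion h f) (u : κ → ZMod 2) :
    ∑ a, f.mulVec u a = h ⬝ᵥ u := by
  simp only [Matrix.mulVec, dotProduct]
  rw [Finset.sum_comm]
  simp_rw [← Finset.sum_mul, hf.sum_eq]

theorem singleRowReduction_mulVec_eq_zero_iff {m n r : ℕ} (H : Matrix (Fin m) (Fin n) (ZMod 2))
    (i : Fin m) (f : Matrix (Fin r) (Fin n) (ZMod 2)) (u : Fin n → ZMod 2)
    (w : Fin (r - 1) → ZMod 2) :
    (singleRowReduction H i f).mulVec (Sum.elim u w) = 0 ↔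
      (∀ j, j ≠ i → H.mulVec u j = 0) ∧ f.mulVec u + (Trep r).mulVec w = 0 := by
  simp [funext_iff, Matrix.mulVec, dotProduct, singleRowReduction]

theorem mulVec_eq_zero_of_singleRowReduction {m n r : ℕ} {H : Matrix (Fin m) (Fin n) (ZMod 2)}
    {i : Fin m} {f : Matrix (Fin r) (Fin n) (ZMod 2)} (hf : IsRowExpansion (H i) f)
    {u : Fin n → ZMod 2} {w : Fin (r - 1) → ZMod 2}
    (hc : (singleRowReduction H i f).mulVec (Sum.elim u w) = 0) : H.mulVec u = 0 := by
  obtain ⟨h1, h2⟩ := (singleRowReduction_mulVec_eq_zero_iff H i f u w).1 hc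
  funext j
  by_cases hj : j = i
  · subst hj
    have h3 : ∑ a, (f.mulVec u + (Trep r).mulVec w) a = 0 := by
      rw [h2]
      simp
    simp only [Pi.add_apply, Finset.sum_add_distrib, sum_Trep_mulVec, hf.sum_mulVec,
      add_zero] at h3
    exact h3
  · exact h1 j hj

theorem exists_singleRowReduction_mulVec_eq_zero {m n r : ℕ}
    {H : Matrix (Fin m) (Fin n) (ZMod 2)} {i : Fin m} {f : Matrix (Fin r) (Fin n) (ZMod 2)}
    (hf : IsRowExpansion (H i) f) {v : Fin n → ZMod 2} (hv : H.mulVec v = 0) :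
    ∃ w, (singleRowReduction H i f).mulVec (Sum.elim v w) = 0 := by
  obtain ⟨w, hw⟩ := exists_Trep_mulVec_eq (f.mulVec v)
    ((hf.sum_mulVec v).trans (congrFun hv i))
  refine ⟨w, (singleRowReduction_mulVec_eq_zero_iff H i f v w).2
    ⟨fun j _ => congrFun hv j, ?_⟩⟩
  rw [hw]
  exact funext fun a => CharTwo.add_self_eq_zero _

theorem hammingNorm_le_hammingNorm_sumElim {α β : Type*} [Fintype α] [Fintype β]
    (u : α → ZMod 2) (w : β → ZMod 2) : hammingNorm u ≤ hammingNorm (Sum.elim u w) := by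
  unfold hammingNorm
  refine Finset.card_le_card_of_injOn Sum.inl ?_ Sum.inl_injective.injOn
  intro a ha
  simpa using ha

/-- Every nonzero codeword of the single-row reduction `H̃` has Hamming weight at least
`d(H)`; in particular, if `C(H)` contains a nonzero vector then `d(H̃) ≥ d(H)`. -/
theorem stmt2 {m n r : ℕ} (hr : 2 ≤ r)
    (H : Matrix (Fin m) (Fin n) (ZMod 2)) (i : Fin m)
    (f : Matrix (Fin r) (Fin n) (ZMod 2)) (hf : IsRowExpansion (H i) f) :
    (∀ c : (Fin n ⊕ Fin (r - 1)) → ZMod 2, c ≠ 0 →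
        (singleRowReduction H i f).mulVec c = 0 →
        minDist H ≤ hammingNorm c) ∧
    ((∃ v : Fin n → ZMod 2, v ≠ 0 ∧ H.mulVec v = 0) →
        minDist H ≤ minDist (singleRowReduction H i f)) := by
  have key : ∀ c : (Fin n ⊕ Fin (r - 1)) → ZMod 2, c ≠ 0 →
      (singleRowReduction H i f).mulVec c = 0 → minDist H ≤ hammingNorm c := by
    intro c hc0 hc
    obtain ⟨u, w, rfl⟩ : ∃ u w, c = Sum.elim u w :=
      ⟨c ∘ Sum.inl, c ∘ Sum.inr, (Sum.elim_comp_inl_inr c).symm⟩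
    have hu : u ≠ 0 := by
      rintro rfl
      have h := ((singleRowReduction_mulVec_eq_zero_iff H i f 0 w).1 hc).2
      rw [Matrix.mulVec_zero, zero_add] at h
      apply hc0
      rw [eq_zero_of_Trep_mulVec_eq_zero h]
      exact Sum.elim_zero_zero
    have hd : minDist H ≤ hammingNorm u :=
      Nat.sInf_le ⟨u, hu, mulVec_eq_zero_of_singleRowReduction hf hc, rfl⟩
    exact hd.trans (hammingNorm_le_hammingNorm_sumElim u w)
  refine ⟨key, ?_⟩
  rintro ⟨v, hv0, hv⟩
  obtain ⟨w, hw⟩ := exists_singleRowReduction_mulVec_eq_zero hf hv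
  refine le_csInf
    ⟨hammingNorm (Sum.elim v w), Sum.elim v w, fun h => hv0 ?_, hw, rfl⟩ ?_
  · exact funext fun a => congrFun h (Sum.inl a)
  · rintro _ ⟨c, hc0, hc, rfl⟩
    exact key c hc0 hc
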